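/- Fix λ, μ ∈ ℝ, set δ = μ − λ, let k = p + 1/2 with p ≥ 1 an integer, let F₁, F₂ ∈ A be homogeneous of the same parity F̃, and let f be one of the contact Hamiltonians x², xθ₁, xθ₂ (of parity f̃). Set Q = F₁∂ₓ^p D̄₁ + F₂∂ₓ^p D̄₂. Then, as operators on A, L^μ_{X_f}∘Q − (−1)^{f̃(F̃+1)} Q∘L^λ_{X_f} = (L^{δ−k}_{X_f}F₁ − (1/2)D̄₁(D̄₂(f))F₂)∂ₓ^p D̄₁ + (L^{δ−k}_{X_f}F₂ + (1/2)D̄₁(D̄₂(f))F₁)∂ₓ^p D̄₂ − (−1)^{F̃+f̃}(p/2 + λ)(D̄₁(f′)F₁ + D̄₂(f′)F₂)∂ₓ^p + (−1)^{f̃+F̃}(p/2)(D̄₁(f′)F₂ − D̄₂(f′)F₁)∂ₓ^{p−1}D̄₁D̄₂ − p(p/2 + λ) f″ F₁ ∂ₓ^{p−1}D̄₁ − p(p/2 + λ) f″ F₂ ∂ₓ^{p−1}D̄₂, where f′ = ∂ₓ(f), f″ = ∂ₓ²(f). -/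

import Mathlib

/-! Model of the superfunctions on the supercircle `S^{1|2}`:
quadruples `f = (f₀, f₁, f₂, f₁₂)` of functions `ℝ → ℝ`, thought of as
`f = f₀ + θ₁f₁ + θ₂f₂ + θ₁θ₂f₁₂` with Grassmann relations
`θ₁θ₂ = −θ₂θ₁`, `θ₁² = θ₂² = 0`. -/
abbrev SF : Type := (ℝ → ℝ) × (ℝ → ℝ) × (ℝ → ℝ) × (ℝ → ℝ)

namespace SF

/-- the coefficient `f₀`. -/
def c0 (f : SF) : ℝ → ℝ := f.1
/-- the coefficient `f₁` of `θ₁`. -/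
def c1 (f : SF) : ℝ → ℝ := f.2.1
/-- the coefficient `f₂` of `θ₂`. -/
def c2 (f : SF) : ℝ → ℝ := f.2.2.1
/-- the coefficient `f₁₂` of `θ₁θ₂`. -/
def c12 (f : SF) : ℝ → ℝ := f.2.2.2

/-- a superfunction is smooth if its four components are. -/
def Smooth (f : SF) : Prop :=
  ContDiff ℝ (⊤ : ℕ∞) f.c0 ∧ ContDiff ℝ (⊤ : ℕ∞) f.c1 ∧
    ContDiff ℝ (⊤ : ℕ∞) f.c2 ∧ ContDiff ℝ (⊤ : ℕ∞) f.c12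

/-- the associative product
`(f₀+θ₁f₁+θ₂f₂+θ₁θ₂f₁₂)(g₀+θ₁g₁+θ₂g₂+θ₁θ₂g₁₂)` determined by the
Grassmann relations `θ₁θ₂ = −θ₂θ₁`, `θ₁² = θ₂² = 0`. -/
def mul (f g : SF) : SF :=
  (f.c0 * g.c0,
   f.c0 * g.c1 + f.c1 * g.c0,
   f.c0 * g.c2 + f.c2 * g.c0,
   f.c0 * g.c12 + f.c12 * g.c0 + f.c1 * g.c2 - f.c2 * g.c1)

/-- `∂ₓ` differentiates each component. -/
noncomputable def dx (f : SF) : SF := (deriv f.c0, deriv f.c1, deriv f.c2, deriv f.c12)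

/-- `∂_{θ₁} f = f₁ + θ₂ f₁₂`. -/
def dθ1 (f : SF) : SF := (f.c1, 0, f.c12, 0)

/-- `∂_{θ₂} f = f₂ − θ₁ f₁₂`. -/
def dθ2 (f : SF) : SF := (f.c2, -f.c12, 0, 0)

/-- the odd coordinate `θ₁` as a superfunction. -/
def θ1 : SF := (0, 1, 0, 0)
/-- the odd coordinate `θ₂` as a superfunction. -/
def θ2 : SF := (0, 0, 1, 0)

/-- `D̄₁ = ∂_{θ₁} − θ₁ ∂ₓ`. -/
noncomputable def D1 (f : SF) : SF := dθ1 f - mul θ1 (dx f)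

/-- `D̄₂ = ∂_{θ₂} − θ₂ ∂ₓ`. -/
noncomputable def D2 (f : SF) : SF := dθ2 f - mul θ2 (dx f)

/-- the contact vector field `X_f = f ∂ₓ − (−1)^{f̃} (1/2)(D̄₁(f) D̄₁ + D̄₂(f) D̄₂)`
of a homogeneous contact Hamiltonian `f` of parity `ε`. -/
noncomputable def X (ε : ℕ) (f : SF) (g : SF) : SF :=
  mul f (dx g) -
    ((-1 : ℝ) ^ ε * (1 / 2 : ℝ)) • (mul (D1 f) (D1 g) + mul (D2 f) (D2 g))

/-- `f` is even: `f₁ = f₂ = 0`. -/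
def IsEven (f : SF) : Prop := f.c1 = 0 ∧ f.c2 = 0

/-- `f` is odd: `f₀ = f₁₂ = 0`. -/
def IsOdd (f : SF) : Prop := f.c0 = 0 ∧ f.c12 = 0

/-- `f` is homogeneous of parity `ε`. -/
def Homog (ε : ℕ) (f : SF) : Prop := if ε % 2 = 0 then IsEven f else IsOdd f

/-- the contact Hamiltonian `1`. -/
def hOne : SF := (1, 0, 0, 0)
/-- the contact Hamiltonian `x`. -/
def hX : SF := (fun x => x, 0, 0, 0)
/-- the contact Hamiltonian `θ₁`. -/
def hθ1 : SF := θ1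
/-- the contact Hamiltonian `θ₂`. -/
def hθ2 : SF := θ2
/-- the contact Hamiltonian `θ₁θ₂`. -/
def hθ1θ2 : SF := (0, 0, 0, 1)
/-- the contact Hamiltonian `x²`. -/
def hX2 : SF := (fun x => x ^ 2, 0, 0, 0)
/-- the contact Hamiltonian `xθ₁`. -/
def hXθ1 : SF := (0, fun x => x, 0, 0)
/-- the contact Hamiltonian `xθ₂`. -/
def hXθ2 : SF := (0, 0, fun x => x, 0)

end SF

namespace SF

/-- the Lie derivative `L^ν_{X_f} = X_f + ν f′` on `ν`-densities, for a homogeneous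
contact Hamiltonian `f` of parity `ε` (with `f′ = ∂ₓ(f)` acting by left multiplication). -/
noncomputable def L (ε : ℕ) (f : SF) (ν : ℝ) (g : SF) : SF :=
  X ε f g + ν • mul (dx f) g

end SF

namespace SF

theorem Smooth.mul {f g : SF} (hf : Smooth f) (hg : Smooth g) : Smooth (mul f g) := by
  obtain ⟨hf0, hf1, hf2, hf12⟩ := hf
  obtain ⟨hg0, hg1, hg2, hg12⟩ := hg
  exact ⟨hf0.mul hg0, (hf0.mul hg1).add (hf1.mul hg0), (hf0.mul hg2).add (hf2.mul hg0),
    (((hf0.mul hg12).add (hf12.mul hg0)).add (hf1.mul hg2)).sub (hf2.mul hg1)⟩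

theorem contDiff_deriv {u : ℝ → ℝ} (hu : ContDiff ℝ (⊤ : ℕ∞) u) :
    ContDiff ℝ (⊤ : ℕ∞) (deriv u) :=
  (contDiff_infty_iff_deriv.1 hu).2

theorem contDiff_deriv_iterate {u : ℝ → ℝ} (hu : ContDiff ℝ (⊤ : ℕ∞) u) (n : ℕ) :
    ContDiff ℝ (⊤ : ℕ∞) (deriv^[n] u) := by
  induction n with
  | zero => exact hu
  | succ n ih => rw [Function.iterate_succ_apply']; exact contDiff_deriv ih

theorem hasDerivAt_deriv_iterate {u : ℝ → ℝ} (hu : ContDiff ℝ (⊤ : ℕ∞) u) (n : ℕ) (x : ℝ) :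
    HasDerivAt (deriv^[n] u) (deriv^[n + 1] u x) x := by
  rw [Function.iterate_succ_apply']
  exact ((contDiff_deriv_iterate hu n).differentiable (by simp) x).hasDerivAt

theorem deriv_iterate_neg (u : ℝ → ℝ) (n : ℕ) : deriv^[n] (-u) = -deriv^[n] u := by
  induction n with
  | zero => rfl
  | succ n ih =>
    rw [Function.iterate_succ_apply', Function.iterate_succ_apply', ih]
    exact deriv.neg'

theorem Smooth.dx {f : SF} (hf : Smooth f) : Smooth (dx f) :=
  ⟨contDiff_deriv hf.1, contDiff_deriv hf.2.1, contDiff_deriv hf.2.2.1,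
    contDiff_deriv hf.2.2.2⟩

theorem Smooth.dx_iterate {f : SF} (hf : Smooth f) (n : ℕ) : Smooth (SF.dx^[n] f) := by
  induction n with
  | zero => exact hf
  | succ n ih => rw [Function.iterate_succ_apply']; exact ih.dx

theorem dx_iterate (n : ℕ) (f : SF) :
    dx^[n] f = (deriv^[n] f.c0, deriv^[n] f.c1, deriv^[n] f.c2, deriv^[n] f.c12) := by
  induction n with
  | zero => rfl
  | succ n ih => simp only [Function.iterate_succ_apply', ih]; rfl

theorem D1_eq (f : SF) : D1 f = (f.c1, -deriv f.c0, f.c12, -deriv f.c2) := by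
  simp [D1, dθ1, θ1, mul, dx, c0, c1, c2, c12]

theorem D2_eq (f : SF) : D2 f = (f.c2, -f.c12, -deriv f.c0, deriv f.c1) := by
  simp [D2, dθ2, θ2, mul, dx, c0, c1, c2, c12]

theorem Smooth.D1 {f : SF} (hf : Smooth f) : Smooth (D1 f) := by
  rw [D1_eq]
  exact ⟨hf.2.1, (contDiff_deriv hf.1).neg, hf.2.2.2, (contDiff_deriv hf.2.2.1).neg⟩

theorem Smooth.D2 {f : SF} (hf : Smooth f) : Smooth (D2 f) := by
  rw [D2_eq]
  exact ⟨hf.2.2.1, hf.2.2.2.neg, (contDiff_deriv hf.1).neg, contDiff_deriv hf.2.1⟩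

theorem dx_iterate_D1 (n : ℕ) (f : SF) :
    dx^[n] (D1 f) =
      (deriv^[n] f.c1, -deriv^[n + 1] f.c0, deriv^[n] f.c12, -deriv^[n + 1] f.c2) := by
  rw [D1_eq, dx_iterate]
  simp only [c0, c1, c2, c12, deriv_iterate_neg, Function.iterate_succ_apply]

theorem dx_iterate_D2 (n : ℕ) (f : SF) :
    dx^[n] (D2 f) =
      (deriv^[n] f.c2, -deriv^[n] f.c12, -deriv^[n + 1] f.c0, deriv^[n + 1] f.c1) := by
  rw [D2_eq, dx_iterate]
  simp only [c0, c1, c2, c12, deriv_iterate_neg, Function.iterate_succ_apply]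

theorem dx_iterate_D1_D2 (n : ℕ) (f : SF) :
    dx^[n] (D1 (D2 f)) =
      (-deriv^[n] f.c12, -deriv^[n + 1] f.c2, deriv^[n + 1] f.c1, deriv^[n + 2] f.c0) := by
  rw [dx_iterate_D1, D2_eq]
  simp only [c0, c1, c2, c12, deriv_iterate_neg, neg_neg, ← Function.iterate_succ_apply]

theorem dx_add {f g : SF} (hf : Smooth f) (hg : Smooth g) : dx (f + g) = dx f + dx g := by
  have key : ∀ {u v : ℝ → ℝ}, ContDiff ℝ (⊤ : ℕ∞) u → ContDiff ℝ (⊤ : ℕ∞) v →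
      deriv (u + v) = deriv u + deriv v := fun hu hv => funext fun x =>
    deriv_add (hu.differentiable (by simp) x) (hv.differentiable (by simp) x)
  exact Prod.ext (key hf.1 hg.1) (Prod.ext (key hf.2.1 hg.2.1)
    (Prod.ext (key hf.2.2.1 hg.2.2.1) (key hf.2.2.2 hg.2.2.2)))

/-- `∂ₓ` is a derivation of the algebra of smooth superfunctions. -/
theorem dx_mul {f g : SF} (hf : Smooth f) (hg : Smooth g) :
    dx (mul f g) = mul (dx f) g + mul f (dx g) := by
  have diff : ∀ {u : ℝ → ℝ}, ContDiff ℝ (⊤ : ℕ∞) u → ∀ x, HasDerivAt u (deriv u x) x :=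
    fun hu x => (hu.differentiable (by simp) x).hasDerivAt
  obtain ⟨hf0, hf1, hf2, hf12⟩ := hf
  obtain ⟨hg0, hg1, hg2, hg12⟩ := hg
  refine Prod.ext (funext fun x => ?_) (Prod.ext (funext fun x => ?_)
    (Prod.ext (funext fun x => ?_) (funext fun x => ?_)))
  · exact ((diff hf0 x).mul (diff hg0 x)).deriv
  · refine (((diff hf0 x).mul (diff hg1 x)).add ((diff hf1 x).mul (diff hg0 x))).deriv.trans ?_
    simp only [mul, dx, c0, c1, Prod.fst_add, Prod.snd_add, Pi.add_apply, Pi.mul_apply]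
    ring
  · refine (((diff hf0 x).mul (diff hg2 x)).add ((diff hf2 x).mul (diff hg0 x))).deriv.trans ?_
    simp only [mul, dx, c0, c2, Prod.fst_add, Prod.snd_add, Pi.add_apply, Pi.mul_apply]
    ring
  · refine (((((diff hf0 x).mul (diff hg12 x)).add ((diff hf12 x).mul (diff hg0 x))).add
      ((diff hf1 x).mul (diff hg2 x))).sub ((diff hf2 x).mul (diff hg1 x))).deriv.trans ?_
    simp only [mul, dx, c0, c1, c2, c12, Prod.snd_add, Pi.add_apply, Pi.sub_apply, Pi.mul_apply]
    ring

/-- Leibniz rule for iterated derivatives of `a x² u' + b x u`. -/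
theorem deriv_iterate_quadratic {u : ℝ → ℝ} (hu : ContDiff ℝ (⊤ : ℕ∞) u) (a b : ℝ) (n : ℕ) :
    deriv^[n + 1] (fun x => a * (x ^ 2 * deriv u x) + b * (x * u x)) = fun x =>
      a * (x ^ 2 * deriv^[n + 2] u x + 2 * (n + 1) * (x * deriv^[n + 1] u x) +
        (n + 1) * n * deriv^[n] u x) +
      b * (x * deriv^[n + 1] u x + (n + 1) * deriv^[n] u x) := by
  have h := hasDerivAt_deriv_iterate hu
  induction n with
  | zero =>
    funext x
    refine (((((hasDerivAt_id x).pow 2).mul (h 1 x)).const_mul a).add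
      (((hasDerivAt_id x).mul (h 0 x)).const_mul b)).deriv.trans ?_
    simp
    ring
  | succ n ih =>
    rw [Function.iterate_succ_apply', ih]
    funext x
    refine ((((((hasDerivAt_id x).pow 2).mul (h (n + 2) x)).add
      (((hasDerivAt_id x).mul (h (n + 1) x)).const_mul (2 * ((n : ℝ) + 1)))).add
      ((h n x).const_mul (((n : ℝ) + 1) * n))).const_mul a |>.add
      ((((hasDerivAt_id x).mul (h (n + 1) x)).add
      ((h n x).const_mul ((n : ℝ) + 1))).const_mul b)).deriv.trans ?_
    simp
    ring

/-- Leibniz rule for iterated derivatives of `a x u' + b u`. -/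
theorem deriv_iterate_linear {u : ℝ → ℝ} (hu : ContDiff ℝ (⊤ : ℕ∞) u) (a b : ℝ) (n : ℕ) :
    deriv^[n] (fun x => a * (x * deriv u x) + b * u x) = fun x =>
      a * (x * deriv^[n + 1] u x + n * deriv^[n] u x) + b * deriv^[n] u x := by
  have h := hasDerivAt_deriv_iterate hu
  induction n with
  | zero => simp
  | succ n ih =>
    rw [Function.iterate_succ_apply', ih]
    funext x
    refine (((((hasDerivAt_id x).mul (h (n + 1) x)).add
      ((h n x).const_mul (n : ℝ))).const_mul a).add ((h n x).const_mul b)).deriv.trans ?_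
    simp only [id, Nat.cast_add, Nat.cast_one]
    ring

/-- Leibniz rule for iterated derivatives of `a x u`. -/
theorem deriv_iterate_id_mul {u : ℝ → ℝ} (hu : ContDiff ℝ (⊤ : ℕ∞) u) (a : ℝ) (n : ℕ) :
    deriv^[n + 1] (fun x => a * (x * u x)) = fun x =>
      a * (x * deriv^[n + 1] u x + (n + 1) * deriv^[n] u x) := by
  simpa using deriv_iterate_quadratic hu 0 a n

theorem dx_hX2 : dx hX2 = (fun x => 2 * x, 0, 0, 0) := by
  have h : deriv (fun x : ℝ => x ^ 2) = fun x => 2 * x := by funext x; simp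
  simp only [dx, hX2, c0, c1, c2, c12, h, deriv_zero]

theorem dx_dx_hX2 : dx (dx hX2) = (fun _ => 2, 0, 0, 0) := by
  have h : deriv (fun x : ℝ => 2 * x) = fun _ => 2 := by funext x; simp
  rw [dx_hX2]
  simp only [dx, c0, c1, c2, c12, h, deriv_zero]

theorem dx_hXθ1 : dx hXθ1 = (0, 1, 0, 0) := by
  have h : deriv (fun x : ℝ => x) = 1 := by funext x; simp
  simp only [dx, hXθ1, c0, c1, c2, c12, h, deriv_zero]

theorem dx_hXθ2 : dx hXθ2 = (0, 0, 1, 0) := by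
  have h : deriv (fun x : ℝ => x) = 1 := by funext x; simp
  simp only [dx, hXθ2, c0, c1, c2, c12, h, deriv_zero]

theorem D1_D2_hX2 : D1 (D2 hX2) = (0, 0, 0, fun _ => 2) := by
  have h : deriv (fun x : ℝ => x ^ 2) = fun x => 2 * x := by funext x; simp
  have h' : deriv (-fun x : ℝ => 2 * x) = fun _ => -2 := by
    funext x; simp [deriv.neg]
  simp only [D1_eq, D2_eq, hX2, c0, c1, c2, c12, h, h', deriv_zero, neg_zero]
  congr
  funext x
  simp

theorem D1_dx_hX2 : D1 (dx hX2) = (0, fun _ => -2, 0, 0) := by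
  have h : deriv (fun x : ℝ => 2 * x) = fun _ => 2 := by funext x; simp
  simp only [dx_hX2, D1_eq, c0, c1, c2, c12, h, deriv_zero, neg_zero]
  rfl

theorem D2_dx_hX2 : D2 (dx hX2) = (0, 0, fun _ => -2, 0) := by
  have h : deriv (fun x : ℝ => 2 * x) = fun _ => 2 := by funext x; simp
  simp only [dx_hX2, D2_eq, c0, c1, c2, c12, h, deriv_zero, neg_zero]
  rfl

theorem D1_D2_hXθ1 : D1 (D2 hXθ1) = (0, 0, 1, 0) := by
  have h : deriv (fun x : ℝ => x) = 1 := by funext x; simp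
  simp [D1_eq, D2_eq, hXθ1, c0, c1, c2, c12, h]

theorem D1_dx_hXθ1 : D1 (dx hXθ1) = (1, 0, 0, 0) := by
  simp [dx_hXθ1, D1_eq, c0, c1, c2, c12]

theorem D2_dx_hXθ1 : D2 (dx hXθ1) = 0 := by
  simp [dx_hXθ1, D2_eq, c0, c1, c2, c12]

theorem dx_dx_hXθ1 : dx (dx hXθ1) = 0 := by
  rw [dx_hXθ1]
  simp [dx, c0, c1, c2, c12]

theorem D1_D2_hXθ2 : D1 (D2 hXθ2) = (0, -1, 0, 0) := by
  have h : deriv (fun x : ℝ => x) = 1 := by funext x; simp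
  simp [D1_eq, D2_eq, hXθ2, c0, c1, c2, c12, h]

theorem D1_dx_hXθ2 : D1 (dx hXθ2) = 0 := by
  simp [dx_hXθ2, D1_eq, c0, c1, c2, c12]

theorem D2_dx_hXθ2 : D2 (dx hXθ2) = (1, 0, 0, 0) := by
  simp [dx_hXθ2, D2_eq, c0, c1, c2, c12]

theorem dx_dx_hXθ2 : dx (dx hXθ2) = 0 := by
  rw [dx_hXθ2]
  simp [dx, c0, c1, c2, c12]

theorem L_hX2 (ν : ℝ) (g : SF) :
    L 0 hX2 ν g =
      (fun x => 1 * (x ^ 2 * (dx g).c0 x) + 2 * ν * (x * g.c0 x),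
       fun x => 1 * (x ^ 2 * (dx g).c1 x) + (2 * ν + 1) * (x * g.c1 x),
       fun x => 1 * (x ^ 2 * (dx g).c2 x) + (2 * ν + 1) * (x * g.c2 x),
       fun x => 1 * (x ^ 2 * (dx g).c12 x) + (2 * ν + 2) * (x * g.c12 x)) := by
  have h : deriv (fun x : ℝ => x ^ 2) = fun x => 2 * x := by funext x; simp
  rw [L, X, dx_hX2, D1_eq, D2_eq, D1_eq, D2_eq]
  simp only [hX2, mul, c0, c1, c2, c12, h, deriv_zero]
  refine Prod.ext (funext fun x => ?_) (Prod.ext (funext fun x => ?_)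
    (Prod.ext (funext fun x => ?_) (funext fun x => ?_))) <;>
  · simp [dx, c0, c1, c2, c12]
    try ring

theorem L_hXθ1 (ν : ℝ) (g : SF) :
    L 1 hXθ1 ν g =
      (fun x => 1 / 2 * (x * g.c1 x),
       fun x => 1 / 2 * (x * (dx g).c0 x) + ν * g.c0 x,
       fun x => 1 / 2 * (x * g.c12 x),
       fun x => 1 / 2 * (x * (dx g).c2 x) + (ν + 1 / 2) * g.c2 x) := by
  have h : deriv (fun x : ℝ => x) = 1 := by funext x; simp
  rw [L, X, dx_hXθ1, D1_eq, D2_eq, D1_eq, D2_eq]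
  simp only [hXθ1, mul, c0, c1, c2, c12, h, deriv_zero]
  refine Prod.ext (funext fun x => ?_) (Prod.ext (funext fun x => ?_)
    (Prod.ext (funext fun x => ?_) (funext fun x => ?_))) <;>
  · simp [dx, c0, c1, c2, c12]
    try ring

theorem L_hXθ2 (ν : ℝ) (g : SF) :
    L 1 hXθ2 ν g =
      (fun x => 1 / 2 * (x * g.c2 x),
       fun x => -(1 / 2) * (x * g.c12 x),
       fun x => 1 / 2 * (x * (dx g).c0 x) + ν * g.c0 x,
       fun x => -(1 / 2) * (x * (dx g).c1 x) + -(ν + 1 / 2) * g.c1 x) := by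
  have h : deriv (fun x : ℝ => x) = 1 := by funext x; simp
  rw [L, X, dx_hXθ2, D1_eq, D2_eq, D1_eq, D2_eq]
  simp only [hXθ2, mul, c0, c1, c2, c12, h, deriv_zero]
  refine Prod.ext (funext fun x => ?_) (Prod.ext (funext fun x => ?_)
    (Prod.ext (funext fun x => ?_) (funext fun x => ?_))) <;>
  · simp [dx, c0, c1, c2, c12]
    try ring

theorem Homog.cases {ε : ℕ} {F : SF} (h : Homog ε F) :
    (Even ε ∧ IsEven F) ∨ (Odd ε ∧ IsOdd F) := by
  unfold Homog at h
  split_ifs at h with hε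
  · exact .inl ⟨Nat.even_iff.2 hε, h⟩
  · exact .inr ⟨Nat.odd_iff.2 (by omega), h⟩

end SF

set_option maxHeartbeats 1000000 in
open SF in
/-- For `f ∈ {x², xθ₁, xθ₂}` of parity `f̃`, `k = p + 1/2` with `p ≥ 1` an integer,
`F₁, F₂` smooth homogeneous of the same parity `F̃`, `δ = μ − λ` and
`Q = F₁∂ₓ^p D̄₁ + F₂∂ₓ^p D̄₂`, the operator
`L^μ_{X_f}∘Q − (−1)^{f̃(F̃+1)} Q∘L^λ_{X_f}` equals
`(L^{δ−k}_{X_f}F₁ − (1/2)D̄₁(D̄₂(f))F₂)∂ₓ^p D̄₁ + (L^{δ−k}_{X_f}F₂ + (1/2)D̄₁(D̄₂(f))F₁)∂ₓ^p D̄₂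
− (−1)^{F̃+f̃}(p/2+λ)(D̄₁(f′)F₁ + D̄₂(f′)F₂)∂ₓ^p
+ (−1)^{f̃+F̃}(p/2)(D̄₁(f′)F₂ − D̄₂(f′)F₁)∂ₓ^{p−1}D̄₁D̄₂
− p(p/2+λ) f″F₁ ∂ₓ^{p−1}D̄₁ − p(p/2+λ) f″F₂ ∂ₓ^{p−1}D̄₂` on `A`. -/
theorem gamma_half_integer_degree (lam μ : ℝ) (p : ℕ) (hp : 1 ≤ p)
    (F1 F2 : SF) (Fε : ℕ) (hF1s : Smooth F1) (hF2s : Smooth F2)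
    (hF1 : Homog Fε F1) (hF2 : Homog Fε F2)
    (f : SF) (fε : ℕ)
    (hf : (f, fε) = (hX2, 0) ∨ (f, fε) = (hXθ1, 1) ∨ (f, fε) = (hXθ2, 1)) :
    ∀ g : SF, Smooth g →
      L fε f μ (mul F1 (dx^[p] (D1 g)) + mul F2 (dx^[p] (D2 g))) -
        ((-1 : ℝ) ^ (fε * (Fε + 1))) •
          (mul F1 (dx^[p] (D1 (L fε f lam g))) + mul F2 (dx^[p] (D2 (L fε f lam g)))) =
      mul (L fε f (μ - lam - ((p : ℝ) + 1 / 2)) F1 - (1 / 2 : ℝ) • mul (D1 (D2 f)) F2)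
        (dx^[p] (D1 g)) +
      mul (L fε f (μ - lam - ((p : ℝ) + 1 / 2)) F2 + (1 / 2 : ℝ) • mul (D1 (D2 f)) F1)
        (dx^[p] (D2 g)) -
      ((-1 : ℝ) ^ (Fε + fε) * ((p : ℝ) / 2 + lam)) •
        mul (mul (D1 (dx f)) F1 + mul (D2 (dx f)) F2) (dx^[p] g) +
      ((-1 : ℝ) ^ (fε + Fε) * ((p : ℝ) / 2)) •
        mul (mul (D1 (dx f)) F2 - mul (D2 (dx f)) F1) (dx^[p - 1] (D1 (D2 g))) -
      ((p : ℝ) * ((p : ℝ) / 2 + lam)) • mul (mul (dx (dx f)) F1) (dx^[p - 1] (D1 g)) -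
      ((p : ℝ) * ((p : ℝ) / 2 + lam)) • mul (mul (dx (dx f)) F2) (dx^[p - 1] (D2 g)) := by
  intro g hg
  obtain ⟨q, rfl⟩ : ∃ q, p = q + 1 := ⟨p - 1, by omega⟩
  have hdQ : dx (mul F1 (dx^[q + 1] (D1 g)) + mul F2 (dx^[q + 1] (D2 g))) =
      mul (dx F1) (dx^[q + 1] (D1 g)) + mul F1 (dx^[q + 2] (D1 g)) +
        (mul (dx F2) (dx^[q + 1] (D2 g)) + mul F2 (dx^[q + 2] (D2 g))) := by
    have h1 := hg.D1.dx_iterate (q + 1)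
    have h2 := hg.D2.dx_iterate (q + 1)
    rw [dx_add (hF1s.mul h1) (hF2s.mul h2), dx_mul hF1s h1, dx_mul hF2s h2,
      ← Function.iterate_succ_apply' dx, ← Function.iterate_succ_apply' dx]
  have hparity : (Even Fε ∧ IsEven F1 ∧ IsEven F2) ∨ (Odd Fε ∧ IsOdd F1 ∧ IsOdd F2) := by
    rcases hF1.cases with ⟨h, h1⟩ | ⟨h, h1⟩ <;> rcases hF2.cases with ⟨h', h2⟩ | ⟨h', h2⟩
    · exact .inl ⟨h, h1, h2⟩
    · exact absurd h (Nat.not_even_iff_odd.2 h')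
    · exact absurd h' (Nat.not_even_iff_odd.2 h)
    · exact .inr ⟨h, h1, h2⟩
  obtain ⟨hg0, hg1, hg2, hg12⟩ := hg
  obtain ⟨g0, g1, g2, g12⟩ := g
  obtain ⟨a0, a1, a2, a12⟩ := F1
  obtain ⟨b0, b1, b2, b12⟩ := F2
  simp only [c0, c1, c2, c12] at hg0 hg1 hg2 hg12
  rcases hf with hf | hf | hf <;> obtain ⟨rfl, rfl⟩ := Prod.mk.inj hf
  · simp only [L_hX2, hdQ]
    simp only [D1_dx_hX2, D2_dx_hX2, D1_D2_hX2, dx_dx_hX2, dx_iterate_D1_D2, Nat.add_sub_cancel]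
    simp only [dx_iterate_D1, dx_iterate_D2]
    simp only [mul, dx, c0, c1, c2, c12, Prod.fst_add, Prod.snd_add,
      dx_iterate, deriv_iterate_quadratic, hg0, hg1, hg2, hg12]
    rcases hparity with ⟨hε, ⟨h1, h2⟩, h3, h4⟩ | ⟨hε, ⟨h1, h2⟩, h3, h4⟩ <;>
    simp only [c0, c1, c2, c12] at h1 h2 h3 h4 <;> subst h1 h2 h3 h4 <;>
    refine Prod.ext (funext fun x => ?_) (Prod.ext (funext fun x => ?_)
      (Prod.ext (funext fun x => ?_) (funext fun x => ?_))) <;>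
    · simp [hε.neg_one_pow]
      try ring
  · simp only [L_hXθ1, hdQ]
    simp only [D1_dx_hXθ1, D2_dx_hXθ1, D1_D2_hXθ1, dx_dx_hXθ1, dx_iterate_D1_D2, Nat.add_sub_cancel]
    simp only [dx_iterate_D1, dx_iterate_D2]
    simp only [mul, dx, c0, c1, c2, c12, Prod.fst_add, Prod.snd_add,
      dx_iterate, deriv_iterate_linear,
      deriv_iterate_id_mul, hg0, hg1, hg2, hg12]
    rcases hparity with ⟨hε, ⟨h1, h2⟩, h3, h4⟩ | ⟨hε, ⟨h1, h2⟩, h3, h4⟩ <;>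
    simp only [c0, c1, c2, c12] at h1 h2 h3 h4 <;> subst h1 h2 h3 h4 <;>
    refine Prod.ext (funext fun x => ?_) (Prod.ext (funext fun x => ?_)
      (Prod.ext (funext fun x => ?_) (funext fun x => ?_))) <;>
    · simp [pow_add, hε.neg_one_pow]
      try ring
  · simp only [L_hXθ2, hdQ]
    simp only [D1_dx_hXθ2, D2_dx_hXθ2, D1_D2_hXθ2, dx_dx_hXθ2, dx_iterate_D1_D2, Nat.add_sub_cancel]
    simp only [dx_iterate_D1, dx_iterate_D2]
    simp only [mul, dx, c0, c1, c2, c12, Prod.fst_add, Prod.snd_add,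
      dx_iterate, deriv_iterate_linear,
      deriv_iterate_id_mul, hg0, hg1, hg2, hg12]
    rcases hparity with ⟨hε, ⟨h1, h2⟩, h3, h4⟩ | ⟨hε, ⟨h1, h2⟩, h3, h4⟩ <;>
    simp only [c0, c1, c2, c12] at h1 h2 h3 h4 <;> subst h1 h2 h3 h4 <;>
    refine Prod.ext (funext fun x => ?_) (Prod.ext (funext fun x => ?_)
      (Prod.ext (funext fun x => ?_) (funext fun x => ?_))) <;>
    · simp [pow_add, hε.neg_one_pow]
      try ring
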